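/- arXiv:1710.05243 — 2 statements merged into one kernel-verified Lean document; each statement's English description precedes it below -/
import Mathlib

section
/- There do not exist continuous functions f_0, f_1, f_2, f_3, f_4 : [0,π] → ℝ, a constant C > 0, and a positive integer N such that |λ_{n,j} − Σ_{k=0}^{4} f_k(jπ/(n+1))/(n+1)^k| ≤ C/(n+1)^5 holds for every n ≥ N and every j ∈ {1,…,n}. -/
open Real Set Filter Topology

/-- The symbol `g(x) = (2 sin(x/2))^4`. -/
noncomputable def g (x : ℝ) : ℝ := (2 * Real.sin (x / 2)) ^ 4

/-- The `n × n` pentadiagonal Toeplitz matrix generated by `g`. -/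
noncomputable def T (n : ℕ) : Matrix (Fin n) (Fin n) ℝ :=
  Matrix.of fun j k =>
    if ((j : ℤ) - (k : ℤ)) = 0 then 6
    else if ((j : ℤ) - (k : ℤ)) = 1 ∨ ((j : ℤ) - (k : ℤ)) = -1 then -4
    else if ((j : ℤ) - (k : ℤ)) = 2 ∨ ((j : ℤ) - (k : ℤ)) = -2 then 1
    else 0

lemma tanh_le_tanh_of_le {x y : ℝ} (h : x ≤ y) : tanh x ≤ tanh y := by
  rw [tanh_eq_sinh_div_cosh, tanh_eq_sinh_div_cosh, div_le_div_iff₀ (cosh_pos _) (cosh_pos _)]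
  have := sinh_nonneg_iff.2 (sub_nonneg.2 h)
  rw [sinh_sub] at this
  linarith

lemma sum_fin_ite_intCast_eq {n : ℕ} (U : ℤ → ℝ) (r : ℤ) (h : r < 0 ∨ (n : ℤ) ≤ r → U r = 0) :
    ∑ k : Fin n, (if (k : ℤ) = r then U k else 0) = U r := by
  by_cases hr : r < 0 ∨ (n : ℤ) ≤ r
  · rw [h hr]
    refine Finset.sum_eq_zero fun k _ => if_neg ?_
    have := k.isLt
    omega
  · push Not at hr
    obtain ⟨m, rfl⟩ := Int.eq_ofNat_of_zero_le hr.1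
    have hm : m < n := by omega
    rw [Finset.sum_eq_single (⟨m, hm⟩ : Fin n)]
    · simp
    · intro k _ hk
      refine if_neg fun h' => hk (Fin.ext ?_)
      simpa using h'
    · simp

/-- A solution of the difference equation that vanishes at two points on either side of
`{0, …, n - 1}`, and does not vanish on that set, is an eigenvector of `T n`. -/
lemma mem_spectrum_T {n : ℕ} {μ : ℝ} (U : ℤ → ℝ)
    (hrec : ∀ k, U (k - 2) - 4 * U (k - 1) + 6 * U k - 4 * U (k + 1) + U (k + 2) = μ * U k)
    (h₁ : U (-2) = 0) (h₂ : U (-1) = 0) (h₃ : U n = 0) (h₄ : U (n + 1) = 0)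
    (hne : ∃ k : Fin n, U k ≠ 0) : μ ∈ spectrum ℝ (T n) := by
  rw [← Matrix.spectrum_toLin', ← Module.End.hasEigenvalue_iff_mem_spectrum]
  refine Module.End.hasEigenvalue_of_hasEigenvector (x := fun k : Fin n => U k) ⟨?_, ?_⟩
  · rw [Module.End.mem_eigenspace_iff]
    ext j
    have hj := j.isLt
    simp only [Matrix.toLin'_apply, Matrix.mulVec, dotProduct, Pi.smul_apply, smul_eq_mul]
    rw [← hrec j]
    have hT : ∀ k : Fin n, T n j k * U k =
        (if (k : ℤ) = (j : ℤ) - 2 then U k else 0) - 4 * (if (k : ℤ) = (j : ℤ) - 1 then U k else 0)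
        + 6 * (if (k : ℤ) = j then U k else 0) - 4 * (if (k : ℤ) = (j : ℤ) + 1 then U k else 0)
        + (if (k : ℤ) = (j : ℤ) + 2 then U k else 0) := by
      intro k
      simp only [T, Matrix.of_apply]
      split_ifs <;> first | omega | ring
    simp only [hT, Finset.sum_add_distrib, Finset.sum_sub_distrib, ← Finset.mul_sum]
    have key : ∀ r : ℤ, -2 ≤ r → r ≤ n + 1 → (r < 0 ∨ (n : ℤ) ≤ r → U r = 0) := by
      intro r hr hr' h
      obtain rfl | rfl | rfl | rfl : r = -2 ∨ r = -1 ∨ r = n ∨ r = n + 1 := by omega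
      all_goals assumption
    rw [sum_fin_ite_intCast_eq U _ (key _ (by omega) (by omega)),
      sum_fin_ite_intCast_eq U _ (key _ (by omega) (by omega)),
      sum_fin_ite_intCast_eq U _ (key _ (by omega) (by omega)),
      sum_fin_ite_intCast_eq U _ (key _ (by omega) (by omega)),
      sum_fin_ite_intCast_eq U _ (key _ (by omega) (by omega))]
  · obtain ⟨k, hk⟩ := hne
    exact fun h => hk (congrFun h k)

lemma mem_spectrum_T_of_add {n : ℕ} (hn : 1 ≤ n) {s : ℝ} (hs : s ≠ 0) (a b : ℤ → ℝ)
    (ha : ∀ k, a (k + 1) + a (k - 1) = 2 * (1 - 2 * s ^ 2) * a k)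
    (hb : ∀ k, b (k + 1) + b (k - 1) = 2 * (1 + 2 * s ^ 2) * b k)
    (h₁ : a (-2) + b (-2) = 0) (h₂ : a (-1) + b (-1) = 0) (h₃ : a n + b n = 0)
    (h₄ : a (n + 1) + b (n + 1) = 0) (hne : b n ≠ 0) : (2 * s) ^ 4 ∈ spectrum ℝ (T n) := by
  refine mem_spectrum_T (fun k => a k + b k) (fun k => ?_) h₁ h₂ h₃ h₄ ?_
  · have e₁ : k + 1 + 1 = k + 2 := by ring
    have e₂ : k + 1 - 1 = k := by ring
    have e₃ : k - 1 + 1 = k := by ring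
    have e₄ : k - 1 - 1 = k - 2 := by ring
    have a₁ := ha (k + 1)
    have a₂ := ha (k - 1)
    have b₁ := hb (k + 1)
    have b₂ := hb (k - 1)
    rw [e₁, e₂] at a₁ b₁
    rw [e₃, e₄] at a₂ b₂
    linear_combination a₁ + a₂ + b₁ + b₂ + (2 * (1 - 2 * s ^ 2) - 4) * ha k
      + (2 * (1 + 2 * s ^ 2) - 4) * hb k
  · by_contra! h
    have h₀ := h ⟨n - 1, by omega⟩
    have hc : (((n - 1 : ℕ) : ℤ)) = (n : ℤ) - 1 := by omega
    simp only [hc] at h₀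
    refine hne ((mul_eq_zero.1 (?_ : 8 * s ^ 2 * b n = 0)).resolve_left (by positivity))
    linear_combination -ha n - hb n + h₀ + h₄ - 2 * (1 - 2 * s ^ 2) * h₃

/-- Condition for an eigenvector symmetric about the midpoint. -/
lemma mem_spectrum_T_of_symm {n : ℕ} (hn : 1 ≤ n) {δ γ : ℝ} (hγ : sinh γ = sin δ)
    (hs : sin δ ≠ 0) (hc : cos δ ≠ 0)
    (h : cos (δ * (n + 2)) * cos δ * sinh (γ * (n + 2))
      + sin (δ * (n + 2)) * cosh γ * cosh (γ * (n + 2)) = 0) :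
    (2 * sin δ) ^ 4 ∈ spectrum ℝ (T n) := by
  have hE : cosh (γ * (n + 1)) * cos (δ * (n + 3)) = cos (δ * (n + 1)) * cosh (γ * (n + 3)) := by
    rw [show γ * ((n : ℝ) + 1) = γ * (n + 2) - γ by ring,
      show γ * ((n : ℝ) + 3) = γ * (n + 2) + γ by ring,
      show δ * ((n : ℝ) + 1) = δ * (n + 2) - δ by ring,
      show δ * ((n : ℝ) + 3) = δ * (n + 2) + δ by ring,
      cosh_sub, cosh_add, cos_sub, cos_add, hγ]
    linear_combination -2 * sin δ * h
  refine mem_spectrum_T_of_add hn hs (fun k => cosh (γ * (n + 1)) * cos (δ * (2 * k - n + 1)))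
    (fun k => -cos (δ * (n + 1)) * cosh (γ * (2 * k - n + 1))) (fun k => ?_) (fun k => ?_)
    ?_ ?_ ?_ ?_ ?_
  · push_cast
    rw [show δ * (2 * ((k : ℝ) + 1) - n + 1) = δ * (2 * k - n + 1) + 2 * δ by ring,
      show δ * (2 * ((k : ℝ) - 1) - n + 1) = δ * (2 * k - n + 1) - 2 * δ by ring,
      cos_add, cos_sub, cos_two_mul, cos_sq']
    ring
  · push_cast
    rw [show γ * (2 * ((k : ℝ) + 1) - n + 1) = γ * (2 * k - n + 1) + 2 * γ by ring,
      show γ * (2 * ((k : ℝ) - 1) - n + 1) = γ * (2 * k - n + 1) - 2 * γ by ring,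
      cosh_add, cosh_sub, cosh_two_mul, cosh_sq, hγ]
    ring
  · push_cast
    rw [show δ * (2 * (-2 : ℝ) - n + 1) = -(δ * (n + 3)) by ring,
      show γ * (2 * (-2 : ℝ) - n + 1) = -(γ * (n + 3)) by ring, cos_neg, cosh_neg]
    linear_combination hE
  · push_cast
    rw [show δ * (2 * (-1 : ℝ) - n + 1) = -(δ * (n + 1)) by ring,
      show γ * (2 * (-1 : ℝ) - n + 1) = -(γ * (n + 1)) by ring, cos_neg, cosh_neg]
    ring
  · push_cast
    rw [show δ * (2 * (n : ℝ) - n + 1) = δ * (n + 1) by ring,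
      show γ * (2 * (n : ℝ) - n + 1) = γ * (n + 1) by ring]
    ring
  · push_cast
    rw [show δ * (2 * ((n : ℝ) + 1) - n + 1) = δ * (n + 3) by ring,
      show γ * (2 * ((n : ℝ) + 1) - n + 1) = γ * (n + 3) by ring]
    linear_combination hE
  · push_cast
    rw [show γ * (2 * (n : ℝ) - n + 1) = γ * (n + 1) by ring]
    refine mul_ne_zero (neg_ne_zero.2 fun h0 => ?_) (cosh_pos _).ne'
    have h1 : cos (δ * (n + 3)) = 0 := by
      rw [h0, zero_mul] at hE
      exact (mul_eq_zero.1 hE).resolve_left (cosh_pos _).ne'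
    have h2 : sin (δ * (n + 1)) ≠ 0 := by
      intro h2
      have := sin_sq_add_cos_sq (δ * (n + 1))
      rw [h0, h2] at this
      norm_num at this
    rw [show δ * ((n : ℝ) + 3) = δ * (n + 1) + 2 * δ by ring, cos_add, h0, sin_two_mul] at h1
    apply mul_ne_zero h2 (mul_ne_zero (mul_ne_zero two_ne_zero hs) hc)
    linarith

/-- Condition for an eigenvector antisymmetric about the midpoint. -/
lemma mem_spectrum_T_of_antisymm {n : ℕ} (hn : 1 ≤ n) {δ γ : ℝ} (hγ : sinh γ = sin δ)
    (hs : sin δ ≠ 0) (hc : cos δ ≠ 0)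
    (h : sin (δ * (n + 2)) * cos δ * cosh (γ * (n + 2))
      - cos (δ * (n + 2)) * cosh γ * sinh (γ * (n + 2)) = 0) :
    (2 * sin δ) ^ 4 ∈ spectrum ℝ (T n) := by
  have hE : sinh (γ * (n + 1)) * sin (δ * (n + 3)) = sin (δ * (n + 1)) * sinh (γ * (n + 3)) := by
    rw [show γ * ((n : ℝ) + 1) = γ * (n + 2) - γ by ring,
      show γ * ((n : ℝ) + 3) = γ * (n + 2) + γ by ring,
      show δ * ((n : ℝ) + 1) = δ * (n + 2) - δ by ring,
      show δ * ((n : ℝ) + 3) = δ * (n + 2) + δ by ring,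
      sinh_sub, sinh_add, sin_sub, sin_add, hγ]
    linear_combination -2 * sin δ * h
  have hsinh : sinh (γ * (n + 1)) ≠ 0 := by
    rw [Ne, sinh_eq_zero]
    refine mul_ne_zero (fun h0 => hs ?_) (by positivity)
    rw [← hγ, h0, sinh_zero]
  refine mem_spectrum_T_of_add hn hs (fun k => sinh (γ * (n + 1)) * sin (δ * (2 * k - n + 1)))
    (fun k => -sin (δ * (n + 1)) * sinh (γ * (2 * k - n + 1))) (fun k => ?_) (fun k => ?_)
    ?_ ?_ ?_ ?_ ?_
  · push_cast
    rw [show δ * (2 * ((k : ℝ) + 1) - n + 1) = δ * (2 * k - n + 1) + 2 * δ by ring,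
      show δ * (2 * ((k : ℝ) - 1) - n + 1) = δ * (2 * k - n + 1) - 2 * δ by ring,
      sin_add, sin_sub, cos_two_mul, cos_sq']
    ring
  · push_cast
    rw [show γ * (2 * ((k : ℝ) + 1) - n + 1) = γ * (2 * k - n + 1) + 2 * γ by ring,
      show γ * (2 * ((k : ℝ) - 1) - n + 1) = γ * (2 * k - n + 1) - 2 * γ by ring,
      sinh_add, sinh_sub, cosh_two_mul, cosh_sq, hγ]
    ring
  · push_cast
    rw [show δ * (2 * (-2 : ℝ) - n + 1) = -(δ * (n + 3)) by ring,
      show γ * (2 * (-2 : ℝ) - n + 1) = -(γ * (n + 3)) by ring, sin_neg, sinh_neg]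
    linear_combination -hE
  · push_cast
    rw [show δ * (2 * (-1 : ℝ) - n + 1) = -(δ * (n + 1)) by ring,
      show γ * (2 * (-1 : ℝ) - n + 1) = -(γ * (n + 1)) by ring, sin_neg, sinh_neg]
    ring
  · push_cast
    rw [show δ * (2 * (n : ℝ) - n + 1) = δ * (n + 1) by ring,
      show γ * (2 * (n : ℝ) - n + 1) = γ * (n + 1) by ring]
    ring
  · push_cast
    rw [show δ * (2 * ((n : ℝ) + 1) - n + 1) = δ * (n + 3) by ring,
      show γ * (2 * ((n : ℝ) + 1) - n + 1) = γ * (n + 3) by ring]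
    linear_combination hE
  · push_cast
    rw [show γ * (2 * (n : ℝ) - n + 1) = γ * (n + 1) by ring]
    refine mul_ne_zero (neg_ne_zero.2 fun h0 => ?_) hsinh
    have h1 : sin (δ * (n + 3)) = 0 := by
      rw [h0, zero_mul] at hE
      exact (mul_eq_zero.1 hE).resolve_left hsinh
    have h2 : cos (δ * (n + 1)) ≠ 0 := by
      intro h2
      have := sin_sq_add_cos_sq (δ * (n + 1))
      rw [h0, h2] at this
      norm_num at this
    rw [show δ * ((n : ℝ) + 3) = δ * (n + 1) + 2 * δ by ring, sin_add, h0, sin_two_mul] at h1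
    apply mul_ne_zero h2 (mul_ne_zero (mul_ne_zero two_ne_zero hs) hc)
    linarith

lemma exists_symm_eigenvalue {n k : ℕ} (hk : 1 ≤ k) (hkn : 2 * k ≤ n + 1) :
    ∃ δ y : ℝ, δ * (n + 2) = k * π - y ∧ 0 < y ∧ y < π / 2 ∧ tan y ≤ tanh (k * π) ∧
      (2 * sin δ) ^ 4 ∈ spectrum ℝ (T n) := by
  have hn : (0 : ℝ) < n + 2 := by positivity
  have hk' : (1 : ℝ) ≤ k := by exact_mod_cast hk
  have hkn' : 2 * (k : ℝ) ≤ n + 1 := by exact_mod_cast hkn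
  have hπ := pi_pos
  let d : ℝ → ℝ := fun y => (k * π - y) / (n + 2)
  have hdn : ∀ y, d y * (n + 2) = k * π - y := fun y => div_mul_cancel₀ _ hn.ne'
  have hd : ∀ y, 0 ≤ y → y ≤ π / 2 → 0 < d y ∧ d y < π / 2 := by
    intro y hy hy'
    refine ⟨div_pos (by nlinarith) hn, ?_⟩
    rw [div_lt_iff₀ hn]
    nlinarith
  let F : ℝ → ℝ := fun y => cos y * cos (d y) * sinh (arsinh (sin (d y)) * (n + 2))
    - sin y * cosh (arsinh (sin (d y))) * cosh (arsinh (sin (d y)) * (n + 2))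
  have hdc : Continuous d := by fun_prop
  have hF : Continuous F := by
    have : Continuous fun y => arsinh (sin (d y)) := continuous_arsinh.comp (by fun_prop)
    fun_prop
  have hsin : ∀ y, 0 ≤ y → y ≤ π / 2 → 0 < sin (d y) := fun y hy hy' =>
    sin_pos_of_pos_of_lt_pi (hd y hy hy').1 (by linarith [(hd y hy hy').2])
  have hcos : ∀ y, 0 ≤ y → y ≤ π / 2 → 0 < cos (d y) := fun y hy hy' =>
    cos_pos_of_mem_Ioo ⟨by linarith [(hd y hy hy').1], (hd y hy hy').2⟩
  have h0 : 0 < F 0 := by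
    have h1 := hcos 0 le_rfl (by positivity)
    have h2 : 0 < sinh (arsinh (sin (d 0)) * (n + 2)) :=
      sinh_pos_iff.2 (mul_pos (arsinh_pos_iff.2 (hsin 0 le_rfl (by positivity))) hn)
    simp only [F, cos_zero, sin_zero, one_mul, zero_mul, sub_zero]
    positivity
  have h1 : F (π / 2) < 0 := by
    simp only [F, cos_pi_div_two, sin_pi_div_two, one_mul, zero_mul, zero_sub, neg_lt_zero]
    exact mul_pos (cosh_pos _) (cosh_pos _)
  obtain ⟨y, ⟨hy0, hy1⟩, hy⟩ := intermediate_value_Ioo' (by positivity) hF.continuousOn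
    (show (0 : ℝ) ∈ Ioo (F (π / 2)) (F 0) from ⟨h1, h0⟩)
  have hcy : 0 < cos y := cos_pos_of_mem_Ioo ⟨by linarith, hy1⟩
  have hs := hsin y hy0.le hy1.le
  have hc := hcos y hy0.le hy1.le
  have hdy := (hd y hy0.le hy1.le).1
  set γ := arsinh (sin (d y)) with hγ
  have hγd : γ ≤ d y :=
    ((self_le_sinh_iff.2 (arsinh_nonneg_iff.2 hs.le)).trans (sinh_arsinh _).le).trans (sin_le hdy.le)
  have hγ0 : 0 < γ := arsinh_pos_iff.2 hs
  have hy' : cos y * cos (d y) * sinh (γ * (n + 2))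
    = sin y * cosh γ * cosh (γ * (n + 2)) := sub_eq_zero.1 hy
  refine ⟨d y, y, hdn y, hy0, hy1, ?_, ?_⟩
  · have hsy : 0 < sin y := sin_pos_of_pos_of_lt_pi hy0 (by linarith)
    refine le_trans (b := tanh (γ * (n + 2))) ?_ (tanh_le_tanh_of_le ?_)
    · rw [tan_eq_sin_div_cos, tanh_eq_sinh_div_cosh, div_le_div_iff₀ hcy (cosh_pos _)]
      have e1 : sin y * cosh (γ * (n + 2)) * 1 ≤ sin y * cosh (γ * (n + 2)) * cosh γ :=
        mul_le_mul_of_nonneg_left (one_le_cosh _) (mul_nonneg hsy.le (cosh_pos _).le)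
      have e2 : cos y * sinh (γ * (n + 2)) * cos (d y) ≤ cos y * sinh (γ * (n + 2)) * 1 :=
        mul_le_mul_of_nonneg_left (cos_le_one _)
          (mul_nonneg hcy.le (sinh_nonneg_iff.2 (by positivity)))
      linarith
    · have := mul_le_mul_of_nonneg_right hγd hn.le
      rw [hdn] at this
      linarith
  · refine mem_spectrum_T_of_symm (by omega) (γ := γ) (sinh_arsinh _) hs.ne' hc.ne' ?_
    rw [hdn, cos_nat_mul_pi_sub, sin_nat_mul_pi_sub]
    linear_combination (-1) ^ k * hy'

lemma exists_antisymm_eigenvalue {n k : ℕ} (hk : 1 ≤ k) (hkn : 2 * k ≤ n) :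
    ∃ δ y : ℝ, δ * (n + 2) = k * π + y ∧ 0 < y ∧ y < π / 2 ∧
      tan y ≤ √(1 + sin ((k * π + π / 2) / (n + 2)) ^ 2) / cos ((k * π + π / 2) / (n + 2)) ∧
      (2 * sin δ) ^ 4 ∈ spectrum ℝ (T n) := by
  have hn : (0 : ℝ) < n + 2 := by positivity
  have hk' : (1 : ℝ) ≤ k := by exact_mod_cast hk
  have hkn' : 2 * (k : ℝ) ≤ n := by exact_mod_cast hkn
  have hπ := pi_pos
  let d : ℝ → ℝ := fun y => (k * π + y) / (n + 2)
  have hdn : ∀ y, d y * (n + 2) = k * π + y := fun y => div_mul_cancel₀ _ hn.ne'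
  have hd : ∀ y, 0 ≤ y → y ≤ π / 2 → 0 < d y ∧ d y < π / 2 := by
    intro y hy hy'
    refine ⟨div_pos (by nlinarith) hn, ?_⟩
    rw [div_lt_iff₀ hn]
    nlinarith
  let F : ℝ → ℝ := fun y => sin y * cos (d y) * cosh (arsinh (sin (d y)) * (n + 2))
    - cos y * cosh (arsinh (sin (d y))) * sinh (arsinh (sin (d y)) * (n + 2))
  have hdc : Continuous d := by fun_prop
  have hF : Continuous F := by
    have : Continuous fun y => arsinh (sin (d y)) := continuous_arsinh.comp (by fun_prop)
    fun_prop
  have hsin : ∀ y, 0 ≤ y → y ≤ π / 2 → 0 < sin (d y) := fun y hy hy' =>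
    sin_pos_of_pos_of_lt_pi (hd y hy hy').1 (by linarith [(hd y hy hy').2])
  have hcos : ∀ y, 0 ≤ y → y ≤ π / 2 → 0 < cos (d y) := fun y hy hy' =>
    cos_pos_of_mem_Ioo ⟨by linarith [(hd y hy hy').1], (hd y hy hy').2⟩
  have h0 : F 0 < 0 := by
    have h2 : 0 < sinh (arsinh (sin (d 0)) * (n + 2)) :=
      sinh_pos_iff.2 (mul_pos (arsinh_pos_iff.2 (hsin 0 le_rfl (by positivity))) hn)
    simp only [F, cos_zero, sin_zero, one_mul, zero_mul, zero_sub, neg_lt_zero]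
    exact mul_pos (cosh_pos _) h2
  have h1 : 0 < F (π / 2) := by
    simp only [F, cos_pi_div_two, sin_pi_div_two, one_mul, zero_mul, sub_zero]
    exact mul_pos (hcos _ (by positivity) le_rfl) (cosh_pos _)
  obtain ⟨y, ⟨hy0, hy1⟩, hy⟩ := intermediate_value_Ioo (by positivity) hF.continuousOn
    (show (0 : ℝ) ∈ Ioo (F 0) (F (π / 2)) from ⟨h0, h1⟩)
  have hcy : 0 < cos y := cos_pos_of_mem_Ioo ⟨by linarith, hy1⟩
  have hs := hsin y hy0.le hy1.le
  have hc := hcos y hy0.le hy1.le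
  have hdy := (hd y hy0.le hy1.le).1
  set γ := arsinh (sin (d y)) with hγ
  have hy' : sin y * cos (d y) * cosh (γ * (n + 2))
    = cos y * cosh γ * sinh (γ * (n + 2)) := sub_eq_zero.1 hy
  refine ⟨d y, y, hdn y, hy0, hy1, ?_, ?_⟩
  · have hψ := hd (π / 2) (by positivity) le_rfl
    have hdψ : d y ≤ d (π / 2) := by
      simp only [d]
      gcongr
    refine le_trans (b := cosh γ / cos (d y)) ?_ ?_
    · rw [tan_eq_sin_div_cos, div_le_div_iff₀ hcy hc]
      refine le_of_mul_le_mul_right ?_ (cosh_pos (γ * (n + 2)))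
      rw [hy', mul_comm (cosh γ)]
      exact mul_le_mul_of_nonneg_left (sinh_lt_cosh _).le (mul_nonneg hcy.le (cosh_pos _).le)
    · rw [hγ, cosh_arsinh]
      refine div_le_div₀ (sqrt_nonneg _) (sqrt_le_sqrt ?_)
        (hcos (π / 2) (by positivity) le_rfl) ?_
      · have := sin_le_sin_of_le_of_le_pi_div_two (by linarith) hψ.2.le hdψ
        gcongr
      · exact cos_le_cos_of_nonneg_of_le_pi hdy.le (by linarith [hψ.2]) hdψ
  · refine mem_spectrum_T_of_antisymm (by omega) (γ := γ) (sinh_arsinh _) hs.ne' hc.ne' ?_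
    rw [hdn, add_comm, cos_add_nat_mul_pi, sin_add_nat_mul_pi]
    linear_combination (-1) ^ k * hy'

/-- Bound for the phase of an antisymmetric eigenvector of index `2 * k`. -/
noncomputable def antisymmBound (k n : ℕ) : ℝ :=
  √(1 + sin ((k * π + π / 2) / (n + 2)) ^ 2) / cos ((k * π + π / 2) / (n + 2))

lemma exists_eigenvalue_mem_Ioo {n m : ℕ} (hm : 1 ≤ m) (hmn : m ≤ n) :
    ∃ δ : ℝ, m * (π / 2) < δ * (n + 2) ∧ δ * (n + 2) < (m + 1) * (π / 2) ∧
      (∀ k : ℕ, m + 1 = 2 * k → k * π - arctan (tanh (k * π)) ≤ δ * (n + 2)) ∧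
      (∀ k : ℕ, m = 2 * k → δ * (n + 2) ≤ k * π + arctan (antisymmBound k n)) ∧
      (2 * sin δ) ^ 4 ∈ spectrum ℝ (T n) := by
  obtain ⟨k, rfl | rfl⟩ := m.even_or_odd'
  · obtain ⟨δ, y, hδ, hy0, hy1, hy, hs⟩ := exists_antisymm_eigenvalue (n := n) (k := k)
      (by omega) hmn
    push_cast
    refine ⟨δ, by linarith, by linarith, fun l hl => by omega, fun l hl => ?_, hs⟩
    obtain rfl : k = l := by omega
    rw [hδ, ← arctan_tan (by linarith) hy1]
    gcongr
    exact hy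
  · obtain ⟨δ, y, hδ, hy0, hy1, hy, hs⟩ := exists_symm_eigenvalue (n := n) (k := k + 1)
      (by omega) (by omega)
    push_cast at hδ ⊢
    refine ⟨δ, by linarith, by linarith, fun l hl => ?_, fun l hl => by omega, hs⟩
    obtain rfl : k + 1 = l := by omega
    rw [hδ, ← arctan_tan (x := y) (by linarith) hy1]
    push_cast at hy ⊢
    gcongr

lemma ncard_spectrum_le {n : ℕ} (A : Matrix (Fin n) (Fin n) ℝ) :
    (spectrum ℝ A).Finite ∧ (spectrum ℝ A).ncard ≤ n := by
  have h : spectrum ℝ A = (A.charpoly.roots.toFinset : Set ℝ) := by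
    ext r
    rw [Matrix.mem_spectrum_iff_isRoot_charpoly]
    simp [A.charpoly_monic.ne_zero]
  rw [h, Set.ncard_coe_finset]
  refine ⟨Finset.finite_toSet _, (Multiset.toFinset_card_le _).trans
    ((Polynomial.card_roots' _).trans ?_)⟩
  simp

lemma range_eq_of_strictMono {n : ℕ} {S : Set ℝ} (hS : S.Finite) (hc : S.ncard ≤ n)
    {f : Fin n → ℝ} (hf : StrictMono f) (hfS : ∀ i, f i ∈ S) : range f = S := by
  refine Set.eq_of_subset_of_ncard_le (range_subset_iff.2 hfS) ?_ hS
  rw [← Set.image_univ, Set.ncard_image_of_injective _ hf.injective, Set.ncard_univ]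
  simpa using hc

/-- The ordered eigenvalues lie one each in the intervals of `exists_eigenvalue_mem_Ioo`. -/
lemma eigenvalue_eq {n : ℕ} {l : ℕ → ℝ} (hmono : ∀ j k, 1 ≤ j → j < k → k ≤ n → l j < l k)
    (hspec : ∀ j, 1 ≤ j → j ≤ n → l j ∈ spectrum ℝ (T n)) {m : ℕ} (hm : 1 ≤ m) (hmn : m ≤ n) :
    ∃ δ : ℝ, 0 < δ ∧ δ < π / 2 ∧ l m = (2 * sin δ) ^ 4 ∧
      (∀ k : ℕ, m + 1 = 2 * k → k * π - arctan (tanh (k * π)) ≤ δ * (n + 2)) ∧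
      (∀ k : ℕ, m = 2 * k → δ * (n + 2) ≤ k * π + arctan (antisymmBound k n)) := by
  choose! δ h₁ h₂ h₃ h₄ h₅ using fun m => fun h : 1 ≤ m ∧ m ≤ n =>
    exists_eigenvalue_mem_Ioo h.1 h.2
  have hπ := pi_pos
  have hn : (0 : ℝ) < n + 2 := by positivity
  have hpos : ∀ i, 1 ≤ i ∧ i ≤ n → 0 < δ i := fun i hi =>
    pos_of_mul_pos_left (lt_of_le_of_lt (by positivity) (h₁ i hi)) hn.le
  have hlt : ∀ i, 1 ≤ i ∧ i ≤ n → δ i < π / 2 := by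
    intro i hi
    have : (i : ℝ) ≤ n := by exact_mod_cast hi.2
    refine lt_of_mul_lt_mul_right ((h₂ i hi).trans ?_) hn.le
    nlinarith
  have hbr : ∀ i : Fin n, 1 ≤ (i : ℕ) + 1 ∧ (i : ℕ) + 1 ≤ n := fun i => ⟨by omega, i.isLt⟩
  have hf : StrictMono fun i : Fin n => l (i + 1) := fun i j hij =>
    hmono _ _ (by omega) (by simpa using hij) (hbr j).2
  have hg : StrictMono fun i : Fin n => (2 * sin (δ (i + 1))) ^ 4 := by
    intro i j hij
    have hij' : ((i : ℕ) : ℝ) + 1 ≤ (j : ℕ) := by exact_mod_cast hij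
    have hδ : δ (i + 1) < δ (j + 1) := by
      have a := h₂ _ (hbr i)
      have b := h₁ _ (hbr j)
      push_cast at a b
      refine lt_of_mul_lt_mul_right (a.trans_le (le_trans ?_ b.le)) hn.le
      gcongr
    have a := hpos _ (hbr i)
    have b := hlt _ (hbr j)
    have c := sin_lt_sin_of_lt_of_le_pi_div_two (by linarith) b.le hδ
    have d : 0 < sin (δ (i + 1)) := sin_pos_of_pos_of_lt_pi a (by linarith)
    simp only
    gcongr
  obtain ⟨hS, hc⟩ := ncard_spectrum_le (T n)
  have hr := (range_eq_of_strictMono hS hc hf fun i => hspec _ (hbr i).1 (hbr i).2).trans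
    (range_eq_of_strictMono hS hc hg fun i => h₅ _ (hbr i)).symm
  have heq := congrFun ((hf.range_inj hg).1 hr) ⟨m - 1, by omega⟩
  simp only [Nat.sub_add_cancel hm] at heq
  exact ⟨δ m, hpos m ⟨hm, hmn⟩, hlt m ⟨hm, hmn⟩, heq, h₃ m ⟨hm, hmn⟩, h₄ m ⟨hm, hmn⟩⟩

lemma tendsto_mul_sin_div (r : ℝ) :
    Tendsto (fun n : ℕ => (((n : ℝ) + 1) * (2 * sin (r / (n + 2)))) ^ 4) atTop
      (𝓝 ((2 * r) ^ 4)) := by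
  have h0 : Tendsto (fun n : ℕ => r / ((n : ℝ) + 2)) atTop (𝓝 0) :=
    tendsto_const_nhds.div_atTop (tendsto_atTop_add_const_right _ _ tendsto_natCast_atTop_atTop)
  have h1 : Tendsto (fun n : ℕ => 1 - 1 / ((n : ℝ) + 2)) atTop (𝓝 1) := by
    simpa using (tendsto_const_nhds (x := (1 : ℝ))).sub
      ((tendsto_const_nhds (x := (1 : ℝ))).div_atTop
        (tendsto_atTop_add_const_right _ (2 : ℝ) tendsto_natCast_atTop_atTop))
  have h2 : Tendsto (fun n : ℕ => sinc (r / ((n : ℝ) + 2))) atTop (𝓝 1) := by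
    simpa [Function.comp_def] using (continuous_sinc.tendsto 0).comp h0
  have h3 := (((h1.mul h2).const_mul (2 * r)).pow 4)
  rw [mul_one, mul_one] at h3
  refine h3.congr fun n => ?_
  have hn : (n : ℝ) + 2 ≠ 0 := by positivity
  congr 1
  have : sin (r / ((n : ℝ) + 2)) = r / (n + 2) * sinc (r / (n + 2)) := by
    by_cases h : r / ((n : ℝ) + 2) = 0
    · simp [h]
    · rw [sinc_of_ne_zero h, mul_div_cancel₀ _ h]
  rw [this]
  field_simp
  ring

lemma tendsto_arctan_antisymmBound (k : ℕ) :
    Tendsto (fun n => (2 * (k * π + arctan (antisymmBound k n))) ^ 4) atTop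
      (𝓝 ((2 * (k * π + π / 4)) ^ 4)) := by
  have h0 : Tendsto (fun n : ℕ => (k * π + π / 2) / ((n : ℝ) + 2)) atTop (𝓝 0) :=
    tendsto_const_nhds.div_atTop (tendsto_atTop_add_const_right _ _ tendsto_natCast_atTop_atTop)
  have h1 : ContinuousAt (fun x : ℝ => (2 * (k * π + arctan (√(1 + sin x ^ 2) / cos x))) ^ 4) 0 :=
    by fun_prop (disch := simp)
  simpa [Function.comp_def, antisymmBound] using h1.tendsto.comp h0

/-- Scaled eigenvalues of odd index are asymptotically at least the fourth power of a frequency of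
the clamped beam. -/
lemma le_scaled_eigenvalue {n k : ℕ} {l : ℕ → ℝ}
    (hmono : ∀ i j, 1 ≤ i → i < j → j ≤ n → l i < l j)
    (hspec : ∀ j, 1 ≤ j → j ≤ n → l j ∈ spectrum ℝ (T n)) (hk : 1 ≤ k) (hkn : 2 * k - 1 ≤ n) :
    (((n : ℝ) + 1) * (2 * sin ((k * π - arctan (tanh (k * π))) / (n + 2)))) ^ 4
      ≤ ((n : ℝ) + 1) ^ 4 * l (2 * k - 1) := by
  obtain ⟨δ, hδ0, hδ1, h, hlow, -⟩ := eigenvalue_eq hmono hspec (m := 2 * k - 1) (by omega) hkn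
  have hn : (0 : ℝ) < n + 2 := by positivity
  have hk' : (1 : ℝ) ≤ k := by exact_mod_cast hk
  have hπ := pi_pos
  have hr : 0 ≤ (k * π - arctan (tanh (k * π))) / (n + 2) := by
    have := arctan_lt_pi_div_two (tanh (k * π))
    refine div_nonneg ?_ hn.le
    nlinarith
  have hle := (div_le_iff₀ hn).2 (hlow k (by omega))
  have h1 := sin_le_sin_of_le_of_le_pi_div_two (by linarith) hδ1.le hle
  have h2 := sin_nonneg_of_nonneg_of_le_pi hr (by linarith)
  rw [h, ← mul_pow]
  gcongr

lemma scaled_eigenvalue_le {n k : ℕ} {l : ℕ → ℝ}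
    (hmono : ∀ i j, 1 ≤ i → i < j → j ≤ n → l i < l j)
    (hspec : ∀ j, 1 ≤ j → j ≤ n → l j ∈ spectrum ℝ (T n)) (hk : 1 ≤ k) (hkn : 2 * k ≤ n) :
    ((n : ℝ) + 1) ^ 4 * l (2 * k) ≤ (2 * (k * π + arctan (antisymmBound k n))) ^ 4 := by
  obtain ⟨δ, hδ0, hδ1, h, -, hup⟩ := eigenvalue_eq hmono hspec (m := 2 * k) (by omega) hkn
  have h1 := sin_le hδ0.le
  have h2 := sin_nonneg_of_nonneg_of_le_pi hδ0.le (by linarith [pi_pos])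
  have h3 := hup k rfl
  rw [h, ← mul_pow]
  gcongr ?_ ^ 4
  calc ((n : ℝ) + 1) * (2 * sin δ) ≤ (n + 2) * (2 * δ) := by gcongr; norm_num
    _ = 2 * (δ * (n + 2)) := by ring
    _ ≤ _ := by gcongr

/-- At a fixed point `d`, an expansion of order four makes the scaled values a quartic polynomial in
the index, up to an error that tends to zero. -/
lemma abs_scaled_sub_quartic_le {F : ℕ → ℝ} {C x N m : ℝ} (hC : 0 < C) (hN : 0 < N) (hm : 1 ≤ m)
    (h : |x - ∑ k ∈ Finset.range 5, F k / (m * N) ^ k| ≤ C / (m * N) ^ 5) :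
    |(m * N) ^ 4 * x - (F 0 * N ^ 4 * m ^ 4 + F 1 * N ^ 3 * m ^ 3 + F 2 * N ^ 2 * m ^ 2
      + F 3 * N * m + F 4)| ≤ C / N := by
  have hmN : 0 < m * N := by positivity
  have e : (m * N) ^ 4 * x - (F 0 * N ^ 4 * m ^ 4 + F 1 * N ^ 3 * m ^ 3 + F 2 * N ^ 2 * m ^ 2
      + F 3 * N * m + F 4) = (m * N) ^ 4 * (x - ∑ k ∈ Finset.range 5, F k / (m * N) ^ k) := by
    simp only [Finset.sum_range_succ, Finset.sum_range_zero]
    field_simp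
    ring
  rw [e, abs_mul, abs_of_pos (by positivity)]
  calc (m * N) ^ 4 * |x - ∑ k ∈ Finset.range 5, F k / (m * N) ^ k|
      ≤ (m * N) ^ 4 * (C / (m * N) ^ 5) := by gcongr
    _ = C / (m * N) := by field_simp
    _ ≤ C / N := by gcongr; nlinarith

theorem stmt0 (lam : ℕ → ℕ → ℝ)
    (hmono : ∀ n, 1 ≤ n → ∀ j k, 1 ≤ j → j < k → k ≤ n → lam n j < lam n k)
    (hspec : ∀ n, 1 ≤ n → ∀ j, 1 ≤ j → j ≤ n → lam n j ∈ spectrum ℝ (T n)) :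
    ¬ ∃ (f : ℕ → ℝ → ℝ) (C : ℝ) (N : ℕ),
      (∀ k ≤ 4, ContinuousOn (f k) (Set.Icc 0 Real.pi)) ∧ 0 < C ∧ 1 ≤ N ∧
      ∀ n, N ≤ n → ∀ j, 1 ≤ j → j ≤ n →
        |lam n j - ∑ k ∈ Finset.range 5,
            f k ((j : ℝ) * Real.pi / ((n : ℝ) + 1)) / ((n : ℝ) + 1) ^ k|
          ≤ C / ((n : ℝ) + 1) ^ 5 := by
  rintro ⟨f, C, N₀, -, hC, -, hexp⟩
  let A : ℕ → ℕ → ℝ := fun m N => ((m : ℝ) * N) ^ 4 * lam (m * N - 1) m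
  let r : ℕ → ℝ := fun k => k * π - arctan (tanh (k * π))
  let lo : ℕ → ℕ → ℝ := fun k n => (((n : ℝ) + 1) * (2 * sin (r k / (n + 2)))) ^ 4
  let up : ℕ → ℕ → ℝ := fun k n => (2 * (k * π + arctan (antisymmBound k n))) ^ 4
  have hcast : ∀ m N : ℕ, 1 ≤ m → 1 ≤ N → (((m * N - 1 : ℕ) : ℝ)) + 1 = m * N := by
    intro m N hm hN
    have : 1 ≤ m * N := Nat.mul_pos hm hN
    push_cast [Nat.cast_sub this]
    ring
  have hA : ∀ m, 1 ≤ m → ∀ N : ℕ, N₀ + 2 ≤ N →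
      |A m N - (f 0 (π / N) * N ^ 4 * m ^ 4 + f 1 (π / N) * N ^ 3 * m ^ 3
        + f 2 (π / N) * N ^ 2 * m ^ 2 + f 3 (π / N) * N * m + f 4 (π / N))| ≤ C / N := by
    intro m hm N hN
    have hm' : (1 : ℝ) ≤ m := by exact_mod_cast hm
    have hN' : (0 : ℝ) < N := by exact_mod_cast (by omega : 0 < N)
    have h1 : N ≤ m * N := Nat.le_mul_of_pos_left N hm
    have h2 : m * 2 ≤ m * N := Nat.mul_le_mul_left m (by omega)
    refine abs_scaled_sub_quartic_le (F := fun k => f k (π / N)) hC hN' hm' ?_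
    have := hexp (m * N - 1) (by omega) m hm (by omega)
    rw [hcast m N hm (by omega), mul_div_mul_left _ _ (by positivity)] at this
    exact this
  have hlo : ∀ k, 1 ≤ k → ∀ N, 2 ≤ N → lo k ((2 * k - 1) * N - 1) ≤ A (2 * k - 1) N := by
    intro k hk N hN
    have h2 : (2 * k - 1) * 2 ≤ (2 * k - 1) * N := Nat.mul_le_mul_left _ hN
    have := le_scaled_eigenvalue (n := (2 * k - 1) * N - 1) (hmono _ (by omega))
      (hspec _ (by omega)) hk (by omega)
    simp only [A]
    rw [← hcast _ N (by omega) (by omega)]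
    exact this
  have hup : ∀ k, 1 ≤ k → ∀ N, 2 ≤ N → A (2 * k) N ≤ up k (2 * k * N - 1) := by
    intro k hk N hN
    have h2 : 2 * k * 2 ≤ 2 * k * N := Nat.mul_le_mul_left _ hN
    have := scaled_eigenvalue_le (n := 2 * k * N - 1) (hmono _ (by omega))
      (hspec _ (by omega)) hk (by omega)
    simp only [A]
    rw [← hcast _ N (by omega) (by omega)]
    exact this
  have hsub : ∀ m, 1 ≤ m → Tendsto (fun N : ℕ => m * N - 1) atTop atTop := fun m hm =>
    (tendsto_sub_atTop_nat 1).comp (tendsto_id.const_mul_atTop' hm)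
  have tlo : ∀ k, 1 ≤ k → Tendsto (fun N => lo k ((2 * k - 1) * N - 1)) atTop
      (𝓝 ((2 * r k) ^ 4)) := fun k hk =>
    (tendsto_mul_sin_div (r k)).comp (hsub (2 * k - 1) (by omega))
  have tup : ∀ k, 1 ≤ k → Tendsto (fun N => up k (2 * k * N - 1)) atTop
      (𝓝 ((2 * (k * π + π / 4)) ^ 4)) := fun k hk =>
    (tendsto_arctan_antisymmBound k).comp (hsub (2 * k) (by omega))
  have herr : Tendsto (fun N : ℕ => 32 * (C / N)) atTop (𝓝 (32 * 0)) :=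
    (tendsto_const_div_atTop_nhds_zero_nat C).const_mul 32
  have hlim := le_of_tendsto_of_tendsto
    (((((tlo 1 le_rfl).sub ((tup 1 le_rfl).const_mul 5)).add
      ((tlo 2 (by norm_num)).const_mul 10)).sub ((tup 2 (by norm_num)).const_mul 10)).add
      ((tlo 3 (by norm_num)).const_mul 5) |>.sub (tup 3 (by norm_num))) herr (by
    filter_upwards [eventually_ge_atTop (N₀ + 2)] with N hN
    have a1 := hA 1 (by norm_num) N hN
    have a2 := hA 2 (by norm_num) N hN
    have a3 := hA 3 (by norm_num) N hN
    have a4 := hA 4 (by norm_num) N hN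
    have a5 := hA 5 (by norm_num) N hN
    have a6 := hA 6 (by norm_num) N hN
    have l1 := hlo 1 (by norm_num) N (by omega)
    have l2 := hlo 2 (by norm_num) N (by omega)
    have l3 := hlo 3 (by norm_num) N (by omega)
    have u1 := hup 1 (by norm_num) N (by omega)
    have u2 := hup 2 (by norm_num) N (by omega)
    have u3 := hup 3 (by norm_num) N (by omega)
    rw [abs_le] at a1 a2 a3 a4 a5 a6
    norm_num only [Nat.cast_ofNat, Nat.cast_one] at a1 a2 a3 a4 a5 a6 l1 l2 l3 u1 u2 u3 ⊢
    linarith)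
  have hr : ∀ k : ℕ, k * π - π / 4 < r k := by
    intro k
    have := arctan_strictMono (tanh_lt_one (k * π))
    rw [arctan_one] at this
    simp only [r]
    linarith
  have hπ := pi_pos
  have hr4 : ∀ k : ℕ, 1 ≤ k → (2 * (k * π - π / 4)) ^ 4 < (2 * r k) ^ 4 := by
    intro k hk
    have hk' : (1 : ℝ) ≤ k := by exact_mod_cast hk
    have : 0 ≤ k * π - π / 4 := by nlinarith
    have := hr k
    gcongr
  have b1 := hr4 1 le_rfl
  have b2 := hr4 2 (by norm_num)
  have b3 := hr4 3 (by norm_num)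
  push_cast at b1 b2 b3 hlim
  ring_nf at b1 b2 b3 hlim
  linarith
end

section
/- There do not exist continuous functions d_0, d_1, d_2, d_3, d_4 : [0,π] → ℝ, a constant C > 0, and a positive integer N such that |λ_{n,j} − Σ_{k=0}^{4} d_k(jπ/(n+2))/(n+2)^k| ≤ C/(n+2)^5 holds for every n ≥ N and every j ∈ {1,…,n}. -/
open Real Set Filter Topology

/-- A sum of entries along one diagonal of a Toeplitz matrix has at most one nonzero term. -/
lemma sum_ite_sub_eq_mul {n : ℕ} (u : ℤ → ℝ) (i : Fin n) (d : ℤ) (c : ℝ)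
    (h : (i : ℤ) - d < 0 ∨ (n : ℤ) ≤ (i : ℤ) - d → u ((i : ℤ) - d + 1) = 0) :
    ∑ k : Fin n, (if (i : ℤ) - (k : ℤ) = d then c else 0) * u ((k : ℤ) + 1)
      = c * u ((i : ℤ) - d + 1) := by
  by_cases hr : (i : ℤ) - d < 0 ∨ (n : ℤ) ≤ (i : ℤ) - d
  · rw [h hr, mul_zero]
    refine Finset.sum_eq_zero fun k _ => ?_
    rw [if_neg (by have := k.2; omega), zero_mul]
  · push Not at hr
    rw [Finset.sum_eq_single (⟨((i : ℤ) - d).toNat, by omega⟩ : Fin n)]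
    · have e : (((i : ℤ) - d).toNat : ℤ) = (i : ℤ) - d := Int.toNat_of_nonneg hr.1
      simp [e]
    · intro k _ hk
      rw [if_neg, zero_mul]
      intro he
      apply hk
      ext
      simp only
      omega
    · simp

lemma T_apply {n : ℕ} (i k : Fin n) :
    T n i k = (if (i : ℤ) - (k : ℤ) = 0 then 6 else 0)
      + (if (i : ℤ) - (k : ℤ) = 1 then -4 else 0) + (if (i : ℤ) - (k : ℤ) = -1 then -4 else 0)
      + (if (i : ℤ) - (k : ℤ) = 2 then 1 else 0) + (if (i : ℤ) - (k : ℤ) = -2 then 1 else 0) := by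
  simp only [T, Matrix.of_apply]
  generalize (i : ℤ) - (k : ℤ) = d
  by_cases h0 : d = 0
  · simp [h0]
  by_cases h1 : d = 1
  · simp [h1]
  by_cases h2 : d = -1
  · simp [h2]
  by_cases h3 : d = 2
  · simp [h3]
  by_cases h4 : d = -2
  · simp [h4]
  simp [h0, h1, h2, h3, h4]

/-- A sum of two solutions of second-order recurrences that satisfies the clamped boundary
conditions is an eigenvector of `T n`. -/
lemma mem_spectrum_T_of_recurrence {n : ℕ} (hn : 1 ≤ n) (p q : ℤ → ℝ) (a b μ : ℝ)
    (hp : ∀ k, p (k + 1) + p (k - 1) = a * p k) (hq : ∀ k, q (k + 1) + q (k - 1) = b * q k)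
    (ha : (a - 2) ^ 2 = μ) (hb : (b - 2) ^ 2 = μ) (hab : a ≠ b)
    (h0 : p 0 + q 0 = 0) (h1 : p (-1) + q (-1) = 0)
    (h2 : p (n + 1) + q (n + 1) = 0) (h3 : p (n + 2) + q (n + 2) = 0)
    (hne : ¬ (p 0 = 0 ∧ p 1 = 0)) : μ ∈ spectrum ℝ (T n) := by
  set u : ℤ → ℝ := fun k => p k + q k with hu
  have hrec : ∀ k, 6 * u k - 4 * u (k - 1) - 4 * u (k + 1) + u (k - 2) + u (k + 2) = μ * u k := by
    intro k
    have p1 := hp (k + 1)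
    have p2 := hp k
    have p3 := hp (k - 1)
    have q1 := hq (k + 1)
    have q2 := hq k
    have q3 := hq (k - 1)
    simp only [add_sub_cancel_right, sub_add_cancel, add_assoc, sub_sub] at p1 p3 q1 q3
    norm_num at p1 p3 q1 q3
    simp only [hu]
    linear_combination p1 + p3 + (a - 4) * p2 + q1 + q3 + (b - 4) * q2 + p k * ha + q k * hb
  have hu0 : ∀ k : ℤ, k = -1 ∨ k = 0 ∨ k = n + 1 ∨ k = n + 2 → u k = 0 := by
    rintro k (rfl | rfl | rfl | rfl) <;> assumption
  rw [← Matrix.spectrum_toLin', ← Module.End.hasEigenvalue_iff_mem_spectrum]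
  refine Module.End.hasEigenvalue_of_hasEigenvector (x := fun k : Fin n => u ((k : ℤ) + 1))
    ⟨?_, ?_⟩
  · rw [Module.End.mem_eigenspace_iff, Matrix.toLin'_apply]
    ext i
    have hi := i.2
    simp only [Matrix.mulVec, dotProduct, T_apply, add_mul, Finset.sum_add_distrib, Pi.smul_apply,
      smul_eq_mul]
    rw [sum_ite_sub_eq_mul, sum_ite_sub_eq_mul, sum_ite_sub_eq_mul, sum_ite_sub_eq_mul,
      sum_ite_sub_eq_mul, ← hrec]
    · rw [show (i : ℤ) - 0 + 1 = i + 1 by ring, show (i : ℤ) - 1 + 1 = i + 1 - 1 by ring,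
        show (i : ℤ) - -1 + 1 = i + 1 + 1 by ring, show (i : ℤ) - 2 + 1 = i + 1 - 2 by ring,
        show (i : ℤ) - -2 + 1 = i + 1 + 2 by ring]
      ring
    all_goals
      intro h
      apply hu0
      omega
  · intro hz
    have hz' : ∀ k : ℤ, 1 ≤ k → k ≤ n → u k = 0 := by
      intro k hk hk'
      have := congrFun hz ⟨(k - 1).toNat, by omega⟩
      simp only [Pi.zero_apply] at this
      rwa [show (((k - 1).toNat : ℕ) : ℤ) + 1 = k by omega] at this
    have u1 : u 1 = 0 := hz' 1 le_rfl (by omega)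
    have u2 : u 2 = 0 := by
      rcases Nat.lt_or_ge n 2 with h | h
      · exact hu0 _ (by omega)
      · exact hz' 2 (by omega) (by omega)
    simp only [hu] at u1 u2
    have p0 := hp 0
    have q0 := hq 0
    have p1 := hp 1
    have q1 := hq 1
    norm_num at p0 q0 p1 q1
    refine hne ⟨?_, ?_⟩
    · have : (a - b) * p 0 = 0 := by linear_combination u1 + h1 - p0 - q0 - b * h0
      exact (mul_eq_zero.1 this).resolve_left (sub_ne_zero.2 hab)
    · have : (a - b) * p 1 = 0 := by linear_combination u2 + h0 - p1 - q1 - b * u1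
      exact (mul_eq_zero.1 this).resolve_left (sub_ne_zero.2 hab)

/-- Half of the positive number `β` with `sinh (β / 2) = sin (φ / 2)`. -/
noncomputable def halfBeta (φ : ℝ) : ℝ := Real.arsinh (Real.sin (φ / 2))

lemma sinh_halfBeta (φ : ℝ) : Real.sinh (halfBeta φ) = Real.sin (φ / 2) := Real.sinh_arsinh _

lemma continuous_halfBeta : Continuous halfBeta := by
  unfold halfBeta
  exact Real.continuous_arsinh.comp (by fun_prop)

lemma cosh_halfBeta (φ : ℝ) : Real.cosh (halfBeta φ) = √(1 + Real.sin (φ / 2) ^ 2) :=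
  Real.cosh_arsinh _

lemma sin_half_pos {φ : ℝ} (h0 : 0 < φ) (hπ : φ < π) : 0 < Real.sin (φ / 2) :=
  Real.sin_pos_of_pos_of_lt_pi (by linarith) (by linarith)

lemma halfBeta_pos {φ : ℝ} (h0 : 0 < φ) (hπ : φ < π) : 0 < halfBeta φ :=
  Real.arsinh_pos_iff.2 (sin_half_pos h0 hπ)

lemma two_cos_sub_two_sq (φ : ℝ) : (2 * Real.cos φ - 2) ^ 2 = g φ := by
  have h1 := Real.cos_sq (φ / 2)
  rw [mul_div_cancel₀ φ two_ne_zero] at h1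
  have h2 := Real.sin_sq_add_cos_sq (φ / 2)
  have : 2 * Real.cos φ - 2 = - (2 * Real.sin (φ / 2)) ^ 2 := by linarith
  rw [this, g]; ring

lemma two_cosh_sub_two (φ : ℝ) :
    2 * Real.cosh (2 * halfBeta φ) - 2 = (2 * Real.sin (φ / 2)) ^ 2 := by
  rw [Real.cosh_two_mul, Real.cosh_sq, sinh_halfBeta]; ring

lemma two_cos_ne_two_cosh {φ : ℝ} (h0 : 0 < φ) (hπ : φ < π) :
    2 * Real.cos φ ≠ 2 * Real.cosh (2 * halfBeta φ) := by
  have := two_cosh_sub_two φ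
  have := Real.cos_le_one φ
  have := sin_half_pos h0 hπ
  have : 0 < (2 * Real.sin (φ / 2)) ^ 2 := by positivity
  linarith

lemma mem_spectrum_T_of_even {n : ℕ} (hn : 1 ≤ n) {φ : ℝ} (h0 : 0 < φ) (hπ : φ < π)
    (h : Real.cos (φ * (n + 2) / 2) * Real.cos (φ / 2) * Real.sinh (halfBeta φ * (n + 2))
      + Real.sin (φ * (n + 2) / 2) * Real.cosh (halfBeta φ * (n + 2)) * Real.cosh (halfBeta φ) = 0) :
    g φ ∈ spectrum ℝ (T n) := by
  set x := φ * (n + 2) / 2 with hx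
  set X := halfBeta φ * (n + 2) with hX
  have key : Real.cosh (X + halfBeta φ) * Real.cos (x - φ / 2)
      + -Real.cos (x + φ / 2) * Real.cosh (X - halfBeta φ) = 0 := by
    rw [Real.cosh_add, Real.cosh_sub, Real.cos_add, Real.cos_sub, sinh_halfBeta]
    linear_combination 2 * Real.sin (φ / 2) * h
  refine mem_spectrum_T_of_recurrence hn
    (fun k => Real.cosh (X + halfBeta φ) * Real.cos (φ * (k - (n + 1) / 2)))
    (fun k => -Real.cos (x + φ / 2) * Real.cosh (2 * halfBeta φ * (k - (n + 1) / 2)))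
    (2 * Real.cos φ) (2 * Real.cosh (2 * halfBeta φ)) _ ?_ ?_ (two_cos_sub_two_sq φ)
    (by rw [two_cosh_sub_two, g]; ring) (two_cos_ne_two_cosh h0 hπ) ?_ ?_ ?_ ?_ ?_
  · intro k
    push_cast
    rw [show φ * ((k : ℝ) + 1 - (n + 1) / 2) = φ * (k - (n + 1) / 2) + φ by ring,
      show φ * ((k : ℝ) - 1 - (n + 1) / 2) = φ * (k - (n + 1) / 2) - φ by ring, Real.cos_add,
      Real.cos_sub]
    ring
  · intro k
    push_cast
    rw [show 2 * halfBeta φ * ((k : ℝ) + 1 - (n + 1) / 2)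
        = 2 * halfBeta φ * (k - (n + 1) / 2) + 2 * halfBeta φ by ring,
      show 2 * halfBeta φ * ((k : ℝ) - 1 - (n + 1) / 2)
        = 2 * halfBeta φ * (k - (n + 1) / 2) - 2 * halfBeta φ by ring, Real.cosh_add,
      Real.cosh_sub]
    ring
  · push_cast
    rw [show φ * ((0 : ℝ) - (n + 1) / 2) = -(x - φ / 2) by rw [hx]; ring,
      show 2 * halfBeta φ * ((0 : ℝ) - (n + 1) / 2) = -(X - halfBeta φ) by rw [hX]; ring,
      Real.cos_neg, Real.cosh_neg]
    exact key
  · push_cast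
    rw [show φ * ((-1 : ℝ) - (n + 1) / 2) = -(x + φ / 2) by rw [hx]; ring,
      show 2 * halfBeta φ * ((-1 : ℝ) - (n + 1) / 2) = -(X + halfBeta φ) by rw [hX]; ring,
      Real.cos_neg, Real.cosh_neg]
    ring
  · push_cast
    rw [show φ * ((n : ℝ) + 1 - (n + 1) / 2) = x - φ / 2 by rw [hx]; ring,
      show 2 * halfBeta φ * ((n : ℝ) + 1 - (n + 1) / 2) = X - halfBeta φ by rw [hX]; ring]
    exact key
  · push_cast
    rw [show φ * ((n : ℝ) + 2 - (n + 1) / 2) = x + φ / 2 by rw [hx]; ring,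
      show 2 * halfBeta φ * ((n : ℝ) + 2 - (n + 1) / 2) = X + halfBeta φ by rw [hX]; ring]
    ring
  · push_cast
    rintro ⟨e0, e1⟩
    have hA := (Real.cosh_pos (X + halfBeta φ)).ne'
    have c0 := (mul_eq_zero.1 e0).resolve_left hA
    have c1 := (mul_eq_zero.1 e1).resolve_left hA
    have hs := (Real.sin_pos_of_pos_of_lt_pi h0 hπ).ne'
    rw [show φ * ((1 : ℝ) - (n + 1) / 2) = φ * (0 - (n + 1) / 2) + φ by ring, Real.cos_add, c0,
      zero_mul, zero_sub, neg_eq_zero] at c1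
    have c2 := (mul_eq_zero.1 c1).resolve_right hs
    have := Real.sin_sq_add_cos_sq (φ * (0 - ((n : ℝ) + 1) / 2))
    rw [c0, c2] at this
    norm_num at this

lemma mem_spectrum_T_of_odd {n : ℕ} (hn : 1 ≤ n) {φ : ℝ} (h0 : 0 < φ) (hπ : φ < π)
    (h : Real.sin (φ * (n + 2) / 2) * Real.cos (φ / 2) * Real.cosh (halfBeta φ * (n + 2))
      - Real.cos (φ * (n + 2) / 2) * Real.sinh (halfBeta φ * (n + 2)) * Real.cosh (halfBeta φ) = 0) :
    g φ ∈ spectrum ℝ (T n) := by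
  set x := φ * (n + 2) / 2 with hx
  set X := halfBeta φ * (n + 2) with hX
  have key : Real.sinh (X + halfBeta φ) * Real.sin (x - φ / 2)
      + -Real.sin (x + φ / 2) * Real.sinh (X - halfBeta φ) = 0 := by
    rw [Real.sinh_add, Real.sinh_sub, Real.sin_add, Real.sin_sub, sinh_halfBeta]
    linear_combination 2 * Real.sin (φ / 2) * h
  refine mem_spectrum_T_of_recurrence hn
    (fun k => Real.sinh (X + halfBeta φ) * Real.sin (φ * (k - (n + 1) / 2)))
    (fun k => -Real.sin (x + φ / 2) * Real.sinh (2 * halfBeta φ * (k - (n + 1) / 2)))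
    (2 * Real.cos φ) (2 * Real.cosh (2 * halfBeta φ)) _ ?_ ?_ (two_cos_sub_two_sq φ)
    (by rw [two_cosh_sub_two, g]; ring) (two_cos_ne_two_cosh h0 hπ) ?_ ?_ ?_ ?_ ?_
  · intro k
    push_cast
    rw [show φ * ((k : ℝ) + 1 - (n + 1) / 2) = φ * (k - (n + 1) / 2) + φ by ring,
      show φ * ((k : ℝ) - 1 - (n + 1) / 2) = φ * (k - (n + 1) / 2) - φ by ring, Real.sin_add,
      Real.sin_sub]
    ring
  · intro k
    push_cast
    rw [show 2 * halfBeta φ * ((k : ℝ) + 1 - (n + 1) / 2)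
        = 2 * halfBeta φ * (k - (n + 1) / 2) + 2 * halfBeta φ by ring,
      show 2 * halfBeta φ * ((k : ℝ) - 1 - (n + 1) / 2)
        = 2 * halfBeta φ * (k - (n + 1) / 2) - 2 * halfBeta φ by ring, Real.sinh_add,
      Real.sinh_sub]
    ring
  · push_cast
    rw [show φ * ((0 : ℝ) - (n + 1) / 2) = -(x - φ / 2) by rw [hx]; ring,
      show 2 * halfBeta φ * ((0 : ℝ) - (n + 1) / 2) = -(X - halfBeta φ) by rw [hX]; ring,
      Real.sin_neg, Real.sinh_neg]
    linear_combination -key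
  · push_cast
    rw [show φ * ((-1 : ℝ) - (n + 1) / 2) = -(x + φ / 2) by rw [hx]; ring,
      show 2 * halfBeta φ * ((-1 : ℝ) - (n + 1) / 2) = -(X + halfBeta φ) by rw [hX]; ring,
      Real.sin_neg, Real.sinh_neg]
    ring
  · push_cast
    rw [show φ * ((n : ℝ) + 1 - (n + 1) / 2) = x - φ / 2 by rw [hx]; ring,
      show 2 * halfBeta φ * ((n : ℝ) + 1 - (n + 1) / 2) = X - halfBeta φ by rw [hX]; ring]
    exact key
  · push_cast
    rw [show φ * ((n : ℝ) + 2 - (n + 1) / 2) = x + φ / 2 by rw [hx]; ring,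
      show 2 * halfBeta φ * ((n : ℝ) + 2 - (n + 1) / 2) = X + halfBeta φ by rw [hX]; ring]
    ring
  · push_cast
    rintro ⟨e0, e1⟩
    have hA : Real.sinh (X + halfBeta φ) ≠ 0 := by
      have := halfBeta_pos h0 hπ
      exact (Real.sinh_pos_iff.2 (by positivity)).ne'
    have c0 := (mul_eq_zero.1 e0).resolve_left hA
    have c1 := (mul_eq_zero.1 e1).resolve_left hA
    have hs := (Real.sin_pos_of_pos_of_lt_pi h0 hπ).ne'
    rw [show φ * ((1 : ℝ) - (n + 1) / 2) = φ * (0 - (n + 1) / 2) + φ by ring, Real.sin_add, c0,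
      zero_mul, zero_add] at c1
    have c2 := (mul_eq_zero.1 c1).resolve_right hs
    have := Real.sin_sq_add_cos_sq (φ * (0 - ((n : ℝ) + 1) / 2))
    rw [c0, c2] at this
    norm_num at this

lemma g_strictMonoOn : StrictMonoOn g (Icc 0 π) := by
  intro a ha b hb hab
  have h0 : 0 ≤ Real.sin (a / 2) :=
    Real.sin_nonneg_of_nonneg_of_le_pi (by linarith [ha.1]) (by linarith [ha.2, Real.pi_pos])
  have h1 : Real.sin (a / 2) < Real.sin (b / 2) :=
    Real.sin_lt_sin_of_lt_of_le_pi_div_two (by linarith [ha.1, Real.pi_pos]) (by linarith [hb.2])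
      (by linarith)
  unfold g
  gcongr

lemma exists_sin_mul_eq_cos_mul {F₁ F₂ : ℝ → ℝ} (h₁ : Continuous F₁) (h₂ : Continuous F₂)
    (hF₁ : 0 < F₁ (π / 2)) (hF₂ : 0 < F₂ 0) :
    ∃ α, 0 < α ∧ α < π / 2 ∧ Real.sin α * F₁ α = Real.cos α * F₂ α := by
  have hc : Continuous fun α => Real.sin α * F₁ α - Real.cos α * F₂ α := by fun_prop
  have hpi : (0 : ℝ) ≤ π / 2 := by positivity
  obtain ⟨α, ⟨ha0, ha1⟩, hα⟩ := intermediate_value_Ioo hpi hc.continuousOn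
    (show (0 : ℝ) ∈ Ioo _ _ by simp [hF₁, hF₂])
  exact ⟨α, ha0, ha1, sub_eq_zero.1 hα⟩

lemma phase_le {n j : ℕ} {φ α : ℝ} (hα1 : α < π / 2)
    (hφ : φ * (n + 2) = j * π + 2 * α) : φ < (j + 1) * π / (n + 2) := by
  rw [lt_div_iff₀ (by positivity)]
  linarith

lemma phase_lt_pi {n j : ℕ} (hjn : j ≤ n) : (j + 1) * π / ((n : ℝ) + 2) < π := by
  have hjn' : (j : ℝ) ≤ n := by exact_mod_cast hjn
  rw [div_lt_iff₀ (by positivity)]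
  nlinarith [Real.pi_pos]

lemma exists_phase {n j : ℕ} (hj : 1 ≤ j) (hjn : j ≤ n) :
    ∃ φ α : ℝ, 0 < α ∧ α < π / 2 ∧ φ * (n + 2) = j * π + 2 * α ∧ g φ ∈ spectrum ℝ (T n) ∧
      (Odd j → Real.sin α * (Real.cos (φ / 2) * Real.sinh (halfBeta φ * (n + 2)))
        = Real.cos α * (Real.cosh (halfBeta φ * (n + 2)) * Real.cosh (halfBeta φ))) ∧
      (Even j → Real.sin α * (Real.cos (φ / 2) * Real.cosh (halfBeta φ * (n + 2)))
        = Real.cos α * (Real.sinh (halfBeta φ * (n + 2)) * Real.cosh (halfBeta φ))) := by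
  have hn2 : (0 : ℝ) < n + 2 := by positivity
  have hn : 1 ≤ n := hj.trans hjn
  have hj' : (1 : ℝ) ≤ j := by exact_mod_cast hj
  set φ : ℝ → ℝ := fun α => (j * π + 2 * α) / (n + 2) with hφ
  have hφe : ∀ α, φ α * (n + 2) = j * π + 2 * α := fun α => div_mul_cancel₀ _ hn2.ne'
  have hφc : Continuous φ := by fun_prop
  have hφ0 : ∀ α, 0 ≤ α → 0 < φ α := fun α hα => by
    have := Real.pi_pos
    simp only [hφ]
    positivity
  have hφπ : ∀ α, α ≤ π / 2 → φ α < π := fun α hα => by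
    refine lt_of_le_of_lt ?_ (phase_lt_pi hjn)
    simp only [hφ]
    gcongr
    linarith
  have hb : ∀ α, 0 ≤ α → α ≤ π / 2 → 0 < halfBeta (φ α) * (n + 2) := fun α h h' =>
    mul_pos (halfBeta_pos (hφ0 α h) (hφπ α h')) hn2
  have hcos : 0 < Real.cos (φ (π / 2) / 2) := by
    have hpi := Real.pi_pos
    have h1 := hφ0 (π / 2) (by positivity)
    have h2 := hφπ (π / 2) le_rfl
    exact Real.cos_pos_of_mem_Ioo ⟨by linarith, by linarith⟩
  have hbc : Continuous fun α => halfBeta (φ α) := continuous_halfBeta.comp hφc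
  have hpi : (0 : ℝ) ≤ π / 2 := by positivity
  rcases Nat.even_or_odd j with he | ho
  · obtain ⟨α, h0, h1, hα⟩ := exists_sin_mul_eq_cos_mul
      (F₁ := fun α => Real.cos (φ α / 2) * Real.cosh (halfBeta (φ α) * (n + 2)))
      (F₂ := fun α => Real.sinh (halfBeta (φ α) * (n + 2)) * Real.cosh (halfBeta (φ α)))
      (by fun_prop) (by fun_prop) (mul_pos hcos (Real.cosh_pos _))
      (mul_pos (Real.sinh_pos_iff.2 (hb 0 le_rfl hpi)) (Real.cosh_pos _))
    refine ⟨φ α, α, h0, h1, hφe α, ?_, fun h => absurd he (Nat.not_even_iff_odd.2 h), fun _ => hα⟩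
    refine mem_spectrum_T_of_odd hn (hφ0 α h0.le) (hφπ α h1.le) ?_
    obtain ⟨i, rfl⟩ := he
    rw [hφe, show ((((i + i : ℕ) : ℝ)) * π + 2 * α) / 2 = α + i * π by push_cast; ring,
      Real.sin_add_nat_mul_pi, Real.cos_add_nat_mul_pi]
    linear_combination (-1 : ℝ) ^ i * hα
  · obtain ⟨α, h0, h1, hα⟩ := exists_sin_mul_eq_cos_mul
      (F₁ := fun α => Real.cos (φ α / 2) * Real.sinh (halfBeta (φ α) * (n + 2)))
      (F₂ := fun α => Real.cosh (halfBeta (φ α) * (n + 2)) * Real.cosh (halfBeta (φ α)))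
      (by fun_prop) (by fun_prop) (mul_pos hcos (Real.sinh_pos_iff.2 (hb _ hpi le_rfl)))
      (mul_pos (Real.cosh_pos _) (Real.cosh_pos _))
    refine ⟨φ α, α, h0, h1, hφe α, ?_, fun _ => hα, fun h => absurd h (Nat.not_even_iff_odd.2 ho)⟩
    refine mem_spectrum_T_of_even hn (hφ0 α h0.le) (hφπ α h1.le) ?_
    obtain ⟨i, rfl⟩ := ho
    rw [hφe, show ((((2 * i + 1 : ℕ) : ℝ)) * π + 2 * α) / 2 = (α + π / 2) + i * π by
        push_cast; ring,
      Real.sin_add_nat_mul_pi, Real.cos_add_nat_mul_pi, Real.sin_add_pi_div_two,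
      Real.cos_add_pi_div_two]
    linear_combination -(-1 : ℝ) ^ i * hα

lemma eq_of_strictMono_of_mem_spectrum {n : ℕ} {A : Matrix (Fin n) (Fin n) ℝ} {u v : Fin n → ℝ}
    (hu : StrictMono u) (hv : StrictMono v) (hus : ∀ i, u i ∈ spectrum ℝ A)
    (hvs : ∀ i, v i ∈ spectrum ℝ A) : u = v := by
  classical
  set s := A.charpoly.roots.toFinset with hs
  have hmem : ∀ x, x ∈ spectrum ℝ A → x ∈ s := fun x hx => by
    rw [hs, Multiset.mem_toFinset, Polynomial.mem_roots (Matrix.charpoly_monic A).ne_zero]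
    exact Matrix.mem_spectrum_iff_isRoot_charpoly.1 hx
  have hle : s.card ≤ n := by
    refine (Multiset.toFinset_card_le _).trans ((Polynomial.card_roots' _).trans ?_)
    simp [Matrix.charpoly_natDegree_eq_dim]
  have hge : n ≤ s.card := by
    have : (Finset.univ.image u).card ≤ s.card := Finset.card_le_card fun x hx => by
      obtain ⟨i, -, rfl⟩ := Finset.mem_image.1 hx
      exact hmem _ (hus i)
    rwa [Finset.card_image_of_injective _ hu.injective, Finset.card_univ, Fintype.card_fin] at this
  have hc : s.card = n := le_antisymm hle hge
  rw [Finset.orderEmbOfFin_unique hc (fun i => hmem _ (hus i)) hu,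
    Finset.orderEmbOfFin_unique hc (fun i => hmem _ (hvs i)) hv]

/-- Every eigenvalue of `T n` is located by a phase `α`. -/
lemma exists_phase_of_eigenvalues {n : ℕ} {l : ℕ → ℝ}
    (hmono : ∀ j k, 1 ≤ j → j < k → k ≤ n → l j < l k)
    (hspec : ∀ j, 1 ≤ j → j ≤ n → l j ∈ spectrum ℝ (T n)) {j : ℕ} (hj : 1 ≤ j) (hjn : j ≤ n) :
    ∃ φ α : ℝ, 0 < α ∧ α < π / 2 ∧ φ * (n + 2) = j * π + 2 * α ∧ l j = g φ ∧
      (Odd j → Real.sin α * (Real.cos (φ / 2) * Real.sinh (halfBeta φ * (n + 2)))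
        = Real.cos α * (Real.cosh (halfBeta φ * (n + 2)) * Real.cosh (halfBeta φ))) ∧
      (Even j → Real.sin α * (Real.cos (φ / 2) * Real.cosh (halfBeta φ * (n + 2)))
        = Real.cos α * (Real.sinh (halfBeta φ * (n + 2)) * Real.cosh (halfBeta φ))) := by
  have hex : ∀ i : Fin n, _ := fun i => exists_phase (n := n) (j := i + 1) (by omega) i.2
  choose φ α h0 h1 hφ hg ho he using hex
  have hpos : (0 : ℝ) < n + 2 := by positivity
  have hmem : ∀ i, φ i ∈ Icc 0 π := fun i => by
    refine ⟨?_, ((phase_le (h1 i) (hφ i)).trans (phase_lt_pi i.2)).le⟩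
    have : 0 ≤ φ i * (n + 2) := by rw [hφ]; have := h0 i; positivity
    exact nonneg_of_mul_nonneg_left this hpos
  have hmonoφ : StrictMono fun i => g (φ i) := fun i k hik => by
    refine g_strictMonoOn (hmem i) (hmem k) (lt_of_mul_lt_mul_right ?_ hpos.le)
    rw [hφ, hφ]
    have hik' : ((i : ℕ) : ℝ) + 1 ≤ (k : ℕ) := by exact_mod_cast hik
    have := h0 k
    have := h1 i
    push_cast
    nlinarith [Real.pi_pos]
  have hl : StrictMono fun i : Fin n => l (i + 1) := fun i k hik =>
    hmono _ _ (by omega) (by simpa using hik) k.2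
  have heq := congrFun (eq_of_strictMono_of_mem_spectrum hl hmonoφ
    (fun i => hspec _ (by omega) i.2) hg) ⟨j - 1, by omega⟩
  have hj1 : j - 1 + 1 = j := by omega
  have hφj := hφ ⟨j - 1, by omega⟩
  have hoj := ho ⟨j - 1, by omega⟩
  have hej := he ⟨j - 1, by omega⟩
  simp only [hj1] at heq hφj hoj hej
  exact ⟨_, _, h0 _, h1 _, hφj, heq, hoj, hej⟩

lemma arctan_le_of_mul_cos_le_sin {c α : ℝ} (h0 : 0 < α) (h1 : α < π / 2)
    (h : c * Real.cos α ≤ Real.sin α) : Real.arctan c ≤ α := by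
  have hc : 0 < Real.cos α := Real.cos_pos_of_mem_Ioo ⟨by linarith, h1⟩
  rw [← Real.arctan_tan (by linarith) h1, Real.tan_eq_sin_div_cos]
  exact Real.arctan_mono ((le_div_iff₀ hc).2 h)

lemma le_arctan_of_sin_le_mul_cos {c α : ℝ} (h0 : 0 < α) (h1 : α < π / 2)
    (h : Real.sin α ≤ c * Real.cos α) : α ≤ Real.arctan c := by
  have hc : 0 < Real.cos α := Real.cos_pos_of_mem_Ioo ⟨by linarith, h1⟩
  rw [← Real.arctan_tan (x := α) (by linarith) h1, Real.tan_eq_sin_div_cos]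
  exact Real.arctan_mono ((div_le_iff₀ hc).2 h)

lemma halfBeta_le {φ : ℝ} (h : 0 ≤ φ) : halfBeta φ ≤ φ / 2 := by
  rw [halfBeta, ← Real.sinh_le_sinh, Real.sinh_arsinh]
  exact (Real.sin_le (by linarith)).trans (Real.self_le_sinh_iff.2 (by linarith))

/-- The tangent of the phase bound for eigenvalues with even index. -/
noncomputable def evenTan (φ : ℝ) : ℝ := √(1 + Real.sin (φ / 2) ^ 2) / Real.cos (φ / 2)

section Bounds

variable {n : ℕ} {l : ℕ → ℝ}

lemma phase_pos {n j : ℕ} {φ α : ℝ} (h0 : 0 < α) (hφ : φ * (n + 2) = j * π + 2 * α) :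
    0 < φ := by
  have : 0 < φ * (n + 2) := by rw [hφ]; positivity
  exact pos_of_mul_pos_left this (by positivity)

lemma g_div_le_g {n j : ℕ} (hjn : j ≤ n) {φ α a : ℝ} (ha : 0 ≤ a) (haα : a ≤ α) (h1 : α < π / 2)
    (hφ : φ * (n + 2) = j * π + 2 * α) : g ((j * π + 2 * a) / (n + 2)) ≤ g φ := by
  have hle : (j * π + 2 * a) / (n + 2) ≤ φ := by
    rw [div_le_iff₀ (by positivity), hφ]
    linarith
  have h0 : 0 ≤ (j * π + 2 * a) / ((n : ℝ) + 2) := by positivity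
  have hπ : φ ≤ π := ((phase_le h1 hφ).trans (phase_lt_pi hjn)).le
  exact g_strictMonoOn.monotoneOn ⟨h0, hle.trans hπ⟩ ⟨h0.trans hle, hπ⟩ hle

lemma cosh_mul_cos_le_sinh_mul_sin {φ α X : ℝ} (h0 : 0 < α) (h1 : α < π / 2) (hX : 0 < X)
    (h : Real.sin α * (Real.cos (φ / 2) * Real.sinh X)
        = Real.cos α * (Real.cosh X * Real.cosh (halfBeta φ))) :
    Real.cosh X * Real.cos α ≤ Real.sinh X * Real.sin α := by
  have hc : 0 < Real.cos α := Real.cos_pos_of_mem_Ioo ⟨by linarith, h1⟩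
  have hs : 0 < Real.sin α := Real.sin_pos_of_pos_of_lt_pi h0 (by linarith)
  have hsX : 0 < Real.sinh X := Real.sinh_pos_iff.2 hX
  have hcX := Real.cosh_pos X
  calc Real.cosh X * Real.cos α = Real.cos α * (Real.cosh X * 1) := by ring
    _ ≤ Real.cos α * (Real.cosh X * Real.cosh (halfBeta φ)) := by
        gcongr
        exact Real.one_le_cosh _
    _ = Real.sin α * (Real.cos (φ / 2) * Real.sinh X) := h.symm
    _ ≤ Real.sin α * (1 * Real.sinh X) := by
        gcongr
        exact Real.cos_le_one _
    _ = Real.sinh X * Real.sin α := by ring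

lemma le_eigenvalue_of_odd (hmono : ∀ j k, 1 ≤ j → j < k → k ≤ n → l j < l k)
    (hspec : ∀ j, 1 ≤ j → j ≤ n → l j ∈ spectrum ℝ (T n)) {j : ℕ} (hjn : j ≤ n) (hodd : Odd j) :
    g ((j * π + 2 * (π / 4)) / (n + 2)) ≤ l j := by
  obtain ⟨φ, α, h0, h1, hφ, hl, ho, -⟩ := exists_phase_of_eigenvalues hmono hspec hodd.pos hjn
  have hφ0 := phase_pos h0 hφ
  have hX := mul_pos (halfBeta_pos hφ0 ((phase_le h1 hφ).trans (phase_lt_pi hjn)))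
    (show (0 : ℝ) < n + 2 by positivity)
  have hc : 0 < Real.cos α := Real.cos_pos_of_mem_Ioo ⟨by linarith, h1⟩
  have key := cosh_mul_cos_le_sinh_mul_sin h0 h1 hX (ho hodd)
  rw [hl]
  refine g_div_le_g hjn (by positivity) ?_ h1 hφ
  rw [← Real.arctan_one]
  refine arctan_le_of_mul_cos_le_sin h0 h1 (le_of_mul_le_mul_left ?_ (Real.sinh_pos_iff.2 hX))
  refine le_trans ?_ key
  rw [one_mul]
  gcongr
  exact (Real.sinh_lt_cosh _).le

lemma le_eigenvalue_one (hmono : ∀ j k, 1 ≤ j → j < k → k ≤ n → l j < l k)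
    (hspec : ∀ j, 1 ≤ j → j ≤ n → l j ∈ spectrum ℝ (T n)) (hn : 1 ≤ n) :
    g ((π + 2 * Real.arctan (Real.cosh π / Real.sinh π)) / (n + 2)) ≤ l 1 := by
  obtain ⟨φ, α, h0, h1, hφ, hl, ho, -⟩ := exists_phase_of_eigenvalues hmono hspec le_rfl hn
  have hφ0 := phase_pos h0 hφ
  have hX := mul_pos (halfBeta_pos hφ0 ((phase_le h1 hφ).trans (phase_lt_pi hn)))
    (show (0 : ℝ) < n + 2 by positivity)
  have hc : 0 < Real.cos α := Real.cos_pos_of_mem_Ioo ⟨by linarith, h1⟩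
  have key := cosh_mul_cos_le_sinh_mul_sin h0 h1 hX (ho odd_one)
  have hsπ : 0 < Real.sinh π := Real.sinh_pos_iff.2 Real.pi_pos
  have hXπ : halfBeta φ * (n + 2) ≤ π := by
    have : halfBeta φ * (n + 2) ≤ φ / 2 * (n + 2) := by
      gcongr
      exact halfBeta_le hφ0.le
    push_cast at hφ
    linarith
  generalize halfBeta φ * (n + 2) = X at *
  have hsX : 0 < Real.sinh X := Real.sinh_pos_iff.2 hX
  have hsub : 0 ≤ Real.sinh (π - X) := Real.sinh_nonneg_iff.2 (by linarith)
  rw [Real.sinh_sub] at hsub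
  rw [hl]
  have := g_div_le_g (a := Real.arctan (Real.cosh π / Real.sinh π)) hn
    (Real.arctan_nonneg.2 (by have := Real.cosh_pos π; positivity)) ?_ h1 hφ
  · simpa using this
  refine arctan_le_of_mul_cos_le_sin h0 h1 ?_
  rw [div_mul_eq_mul_div, div_le_iff₀ hsπ]
  refine le_of_mul_le_mul_left ?_ hsX
  nlinarith [mul_le_mul_of_nonneg_right key hsπ.le, mul_nonneg hsub hc.le]

lemma eigenvalue_le_of_even (hmono : ∀ j k, 1 ≤ j → j < k → k ≤ n → l j < l k)
    (hspec : ∀ j, 1 ≤ j → j ≤ n → l j ∈ spectrum ℝ (T n)) {j : ℕ} (hj : 1 ≤ j) (hjn : j ≤ n)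
    (heven : Even j) :
    ((n : ℝ) + 2) ^ 4 * l j
      ≤ (j * π + 2 * Real.arctan (evenTan ((j + 1) * π / (n + 2)))) ^ 4 := by
  obtain ⟨φ, α, h0, h1, hφ, hl, -, he⟩ := exists_phase_of_eigenvalues hmono hspec hj hjn
  have hφ0 := phase_pos h0 hφ
  have hφ1 := phase_le h1 hφ
  have hφ2 := phase_lt_pi hjn
  have hpi := Real.pi_pos
  set ψ := (j + 1) * π / ((n : ℝ) + 2)
  have hc : 0 < Real.cos α := Real.cos_pos_of_mem_Ioo ⟨by linarith, h1⟩
  have hcφ : 0 < Real.cos (φ / 2) := Real.cos_pos_of_mem_Ioo ⟨by linarith, by linarith⟩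
  have hcψ : 0 < Real.cos (ψ / 2) := Real.cos_pos_of_mem_Ioo ⟨by linarith, by linarith⟩
  have hs0 : 0 < Real.sin (φ / 2) := sin_half_pos hφ0 (hφ1.trans hφ2)
  have hs : Real.sin (φ / 2) ≤ Real.sin (ψ / 2) :=
    Real.sin_le_sin_of_le_of_le_pi_div_two (by linarith) (by linarith) (by linarith)
  have hcc : Real.cos (ψ / 2) ≤ Real.cos (φ / 2) :=
    Real.cos_le_cos_of_nonneg_of_le_pi (by linarith) (by linarith) (by linarith)
  have hα : α ≤ Real.arctan (evenTan ψ) := by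
    refine (le_arctan_of_sin_le_mul_cos (c := evenTan φ) h0 h1 ?_).trans (Real.arctan_mono ?_)
    · have hX := Real.cosh_pos (halfBeta φ * (n + 2))
      have h2 := Real.cosh_pos (halfBeta φ)
      rw [evenTan, ← cosh_halfBeta, div_mul_eq_mul_div, le_div_iff₀ hcφ]
      refine le_of_mul_le_mul_right ?_ hX
      calc _ = Real.sin α * (Real.cos (φ / 2) * Real.cosh (halfBeta φ * (n + 2))) := by ring
        _ = Real.cos α * (Real.sinh (halfBeta φ * (n + 2)) * Real.cosh (halfBeta φ)) := he heven
        _ ≤ Real.cos α * (Real.cosh (halfBeta φ * (n + 2)) * Real.cosh (halfBeta φ)) := by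
          gcongr
          exact (Real.sinh_lt_cosh _).le
        _ = _ := by ring
    · unfold evenTan
      gcongr
  calc ((n : ℝ) + 2) ^ 4 * l j = ((n + 2) * (2 * Real.sin (φ / 2))) ^ 4 := by rw [hl, g]; ring
    _ ≤ ((n + 2) * (2 * (φ / 2))) ^ 4 := by
        gcongr
        exact Real.sin_le (by linarith)
    _ = (j * π + 2 * α) ^ 4 := by rw [← hφ]; ring
    _ ≤ _ := by gcongr

end Bounds

lemma tendsto_pow_mul_g_div (c : ℝ) :
    Tendsto (fun x : ℝ => x ^ 4 * g (c / x)) atTop (𝓝 (c ^ 4)) := by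
  have h : Tendsto (fun x : ℝ => (c * Real.sinc (c / x / 2)) ^ 4) atTop (𝓝 (c ^ 4)) := by
    have h1 : Tendsto (fun x : ℝ => c / x / 2) atTop (𝓝 0) := by
      simpa using (tendsto_id.const_div_atTop c).div_const 2
    have h2 := (Real.continuous_sinc.tendsto 0).comp h1
    simpa using (h2.const_mul c).pow 4
  refine h.congr' ?_
  filter_upwards [eventually_gt_atTop 0] with x hx
  rcases eq_or_ne c 0 with rfl | hc
  · simp [g]
  rw [Real.sinc_of_ne_zero (by positivity), g]
  field_simp

lemma tendsto_arctan_evenTan (c d : ℝ) :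
    Tendsto (fun x : ℝ => (c + 2 * Real.arctan (evenTan (d / x))) ^ 4) atTop
      (𝓝 ((c + 2 * (π / 4)) ^ 4)) := by
  have h1 : Tendsto (fun x : ℝ => d / x) atTop (𝓝 0) := tendsto_id.const_div_atTop d
  have h2 : ContinuousAt evenTan 0 := by
    unfold evenTan
    refine ContinuousAt.div (by fun_prop) (by fun_prop) (by simp)
  have h3 : Tendsto (fun x : ℝ => evenTan (d / x)) atTop (𝓝 1) := by
    have := h2.tendsto.comp h1
    rwa [show evenTan 0 = 1 by simp [evenTan]] at this
  have h4 := (Real.continuous_arctan.tendsto 1).comp h3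
  rw [Real.arctan_one] at h4
  exact ((h4.const_mul 2).const_add c).pow 4

lemma pi_div_four_lt_arctan_coth : π / 4 < Real.arctan (Real.cosh π / Real.sinh π) := by
  rw [← Real.arctan_one]
  refine Real.arctan_strictMono ?_
  rw [lt_div_iff₀ (Real.sinh_pos_iff.2 Real.pi_pos), one_mul]
  exact Real.sinh_lt_cosh _

/-- The remainder of a fourth-order expansion, after scaling by the fourth power. -/
lemma abs_scaled_sub_le {C x s l : ℝ} {d : ℕ → ℝ} (hC : 0 < C) (hx : 0 < x) (hs : 1 ≤ s)
    (h : |l - ∑ k ∈ Finset.range 5, d k / (s * x) ^ k| ≤ C / (s * x) ^ 5) :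
    |(s * x) ^ 4 * l - (d 0 * x ^ 4 * s ^ 4 + d 1 * x ^ 3 * s ^ 3 + d 2 * x ^ 2 * s ^ 2
      + d 3 * x * s + d 4)| ≤ C / x := by
  have hs0 : 0 < s := by linarith
  have e : (s * x) ^ 4 * l - (d 0 * x ^ 4 * s ^ 4 + d 1 * x ^ 3 * s ^ 3 + d 2 * x ^ 2 * s ^ 2
      + d 3 * x * s + d 4) = (s * x) ^ 4 * (l - ∑ k ∈ Finset.range 5, d k / (s * x) ^ k) := by
    simp only [Finset.sum_range_succ, Finset.sum_range_zero]
    field_simp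
    ring
  rw [e, abs_mul, abs_of_pos (by positivity)]
  calc (s * x) ^ 4 * |l - ∑ k ∈ Finset.range 5, d k / (s * x) ^ k|
      ≤ (s * x) ^ 4 * (C / (s * x) ^ 5) := by gcongr
    _ = C / (s * x) := by field_simp
    _ ≤ C / x := by
        gcongr
        nlinarith

theorem stmt3 (lam : ℕ → ℕ → ℝ)
    (hmono : ∀ n, 1 ≤ n → ∀ j k, 1 ≤ j → j < k → k ≤ n → lam n j < lam n k)
    (hspec : ∀ n, 1 ≤ n → ∀ j, 1 ≤ j → j ≤ n → lam n j ∈ spectrum ℝ (T n)) :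
    ¬ ∃ (d : ℕ → ℝ → ℝ) (C : ℝ) (N : ℕ),
      (∀ k ≤ 4, ContinuousOn (d k) (Set.Icc 0 Real.pi)) ∧ 0 < C ∧ 1 ≤ N ∧
      ∀ n, N ≤ n → ∀ j, 1 ≤ j → j ≤ n →
        |lam n j - ∑ k ∈ Finset.range 5,
            d k ((j : ℝ) * Real.pi / ((n : ℝ) + 2)) / ((n : ℝ) + 2) ^ k|
          ≤ C / ((n : ℝ) + 2) ^ 5 := by
  rintro ⟨d, C, N, -, hC, -, hexp⟩
  set c₁ := π + 2 * Real.arctan (Real.cosh π / Real.sinh π) with hc₁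
  let L : ℝ → ℝ → ℝ := fun c x => x ^ 4 * g (c / x)
  let U : ℕ → ℝ → ℝ := fun j x =>
    (j * π + 2 * Real.arctan (evenTan ((j + 1) * π / x))) ^ 4
  have hcast : ∀ s : ℕ, 1 ≤ s → Tendsto (fun M : ℕ => (s : ℝ) * M) atTop atTop := fun s hs =>
    tendsto_natCast_atTop_atTop.const_mul_atTop (by exact_mod_cast hs)
  have hL : ∀ (s : ℕ) (c : ℝ), 1 ≤ s →
      Tendsto (fun M : ℕ => L c (s * M)) atTop (𝓝 (c ^ 4)) := fun s c hs =>
    (tendsto_pow_mul_g_div c).comp (hcast s hs)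
  have hU : ∀ s : ℕ, 1 ≤ s →
      Tendsto (fun M : ℕ => U s (s * M)) atTop (𝓝 ((s * π + 2 * (π / 4)) ^ 4)) := fun s hs =>
    (tendsto_arctan_evenTan _ _).comp (hcast s hs)
  have hlim := ((((((hL 1 c₁ le_rfl).sub ((hU 2 (by norm_num)).const_mul 5)).add
    ((hL 3 ((3 : ℕ) * π + 2 * (π / 4)) (by norm_num)).const_mul 10)).sub
    ((hU 4 (by norm_num)).const_mul 10)).add
    ((hL 5 ((5 : ℕ) * π + 2 * (π / 4)) (by norm_num)).const_mul 5)).sub (hU 6 (by norm_num)))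
  have hrem : Tendsto (fun M : ℕ => 32 * C / (M : ℝ)) atTop (𝓝 0) :=
    tendsto_const_div_atTop_nhds_zero_nat _
  have hle := le_of_tendsto_of_tendsto hlim hrem ?_
  · have h1 : (π + 2 * (π / 4)) ^ 4 < c₁ ^ 4 := by
      have := pi_div_four_lt_arctan_coth
      have := Real.pi_pos
      rw [hc₁]
      gcongr
    push_cast at hle
    nlinarith
  · filter_upwards [eventually_ge_atTop (N + 8)] with M hM
    have hM0 : (0 : ℝ) < M := by exact_mod_cast (by omega : 0 < M)
    have hsn : ∀ s : ℕ, 1 ≤ s → s ≤ 6 → ∃ n, N ≤ n ∧ 1 ≤ n ∧ s ≤ n ∧ (n : ℝ) + 2 = s * M := by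
      intro s hs hs6
      have hsM : M ≤ s * M := Nat.le_mul_of_pos_left _ hs
      refine ⟨s * M - 2, by omega, by omega, by omega, ?_⟩
      exact_mod_cast (by omega : s * M - 2 + 2 = s * M)
    have herr : ∀ (n s : ℕ), 1 ≤ s → N ≤ n → s ≤ n → (n : ℝ) + 2 = s * M → _ :=
      fun n s hs hN hsn hn => abs_le.1 <|
        abs_scaled_sub_le (s := (s : ℝ)) (l := lam n s) (d := fun k => d k (π / M)) hC hM0
          (by exact_mod_cast hs) (by
          have := hexp n hN s hs hsn
          rwa [hn, mul_div_mul_left _ _ (by positivity)] at this)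
    have hodd : ∀ (n s : ℕ), Odd s → 1 ≤ n → s ≤ n → (n : ℝ) + 2 = s * M →
        L (s * π + 2 * (π / 4)) (s * M) ≤ (s * M) ^ 4 * lam n s := by
      intro n s hs hn hsn he
      have := le_eigenvalue_of_odd (hmono n hn) (hspec n hn) hsn hs
      rw [he] at this
      simp only [L]
      gcongr
    have heven : ∀ (n s : ℕ), Even s → 1 ≤ s → 1 ≤ n → s ≤ n → (n : ℝ) + 2 = s * M →
        (s * M) ^ 4 * lam n s ≤ U s (s * M) := by
      intro n s hs hs1 hn hsn he
      have := eigenvalue_le_of_even (hmono n hn) (hspec n hn) hs1 hsn hs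
      rwa [he] at this
    obtain ⟨n₁, hN₁, hn₁, hs₁, he₁⟩ := hsn 1 (by norm_num) (by norm_num)
    obtain ⟨n₂, hN₂, hn₂, hs₂, he₂⟩ := hsn 2 (by norm_num) (by norm_num)
    obtain ⟨n₃, hN₃, hn₃, hs₃, he₃⟩ := hsn 3 (by norm_num) (by norm_num)
    obtain ⟨n₄, hN₄, hn₄, hs₄, he₄⟩ := hsn 4 (by norm_num) (by norm_num)
    obtain ⟨n₅, hN₅, hn₅, hs₅, he₅⟩ := hsn 5 (by norm_num) (by norm_num)
    obtain ⟨n₆, hN₆, hn₆, hs₆, he₆⟩ := hsn 6 (by norm_num) (by norm_num)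
    have b₁ : L c₁ ((1 : ℕ) * M) ≤ ((1 : ℕ) * (M : ℝ)) ^ 4 * lam n₁ 1 := by
      have := le_eigenvalue_one (hmono n₁ hn₁) (hspec n₁ hn₁) hn₁
      rw [he₁] at this
      simp only [L]
      gcongr
    have b₂ := heven n₂ 2 (by decide) (by norm_num) hn₂ hs₂ he₂
    have b₃ := hodd n₃ 3 (by decide) hn₃ hs₃ he₃
    have b₄ := heven n₄ 4 (by decide) (by norm_num) hn₄ hs₄ he₄
    have b₅ := hodd n₅ 5 (by decide) hn₅ hs₅ he₅
    have b₆ := heven n₆ 6 (by decide) (by norm_num) hn₆ hs₆ he₆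
    have r₁ := (herr n₁ 1 (by norm_num) hN₁ hs₁ he₁).2
    have r₂ := (herr n₂ 2 (by norm_num) hN₂ hs₂ he₂).1
    have r₃ := (herr n₃ 3 (by norm_num) hN₃ hs₃ he₃).2
    have r₄ := (herr n₄ 4 (by norm_num) hN₄ hs₄ he₄).1
    have r₅ := (herr n₅ 5 (by norm_num) hN₅ hs₅ he₅).2
    have r₆ := (herr n₆ 6 (by norm_num) hN₆ hs₆ he₆).1
    rw [mul_div_assoc]
    generalize C / (M : ℝ) = ε at *
    clear_value L U
    push_cast at b₁ b₂ b₃ b₄ b₅ b₆ r₁ r₂ r₃ r₄ r₅ r₆ ⊢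
    linarith
end
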